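/- For any β > 0, any finite Λ ⊂ ℤ², any boundary condition ξ, any h ∈ ℤ and any contour γ, the SOS measure without floor and without ceiling satisfies π̂_Λ^ξ( C_{γ,h} ) ≤ exp(−β|γ|). Moreover, if h' < h and γ, γ' are contours with Λ_γ ⊆ Λ_{γ'}, then π̂_Λ^ξ( C_{γ,h} | C_{γ',h'} ) ≤ exp(−β|γ|). -/

import Mathlib

open scoped Classical
open Filter

noncomputable section

namespace SOSPaper

/-- Sites of the lattice `ℤ²`. -/
abbrev Site : Type := ℤ × ℤ

/-- Height configurations on `ℤ²`. -/
abbrev Config : Type := Site → ℤ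

/-- Nearest-neighbour adjacency on `ℤ²`. -/
def SiteAdj (x y : Site) : Prop := (x.1 - y.1).natAbs + (x.2 - y.2).natAbs = 1

/-- The four nearest neighbours of a site. -/
def nbrs (x : Site) : Finset Site :=
  {(x.1 + 1, x.2), (x.1 - 1, x.2), (x.1, x.2 + 1), (x.1, x.2 - 1)}

/-- The SOS Hamiltonian on `Λ` with boundary condition `ξ`:
`H_Λ^ξ(η) = (1/2) Σ_{x,y∈Λ adjacent} |η_x-η_y| + Σ_{x∈Λ, y∉Λ adjacent} |η_x-ξ_y|`. -/
def sosH (Λ : Finset Site) (ξ : Config) (η : Config) : ℝ :=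
  (1 / 2) * ∑ x ∈ Λ, ∑ y ∈ (nbrs x).filter (fun y => y ∈ Λ), ((|η x - η y| : ℤ) : ℝ)
    + ∑ x ∈ Λ, ∑ y ∈ (nbrs x).filter (fun y => y ∉ Λ), ((|η x - ξ y| : ℤ) : ℝ)

/-- Extension of `g : Λ → ℤ` by the boundary condition `ξ` off `Λ`. -/
def extendC (Λ : Finset Site) (ξ : Config) (g : {x // x ∈ Λ} → ℤ) : Config :=
  fun x => if h : x ∈ Λ then g ⟨x, h⟩ else ξ x

/-- Gibbs weight `exp(-β·H_Λ^ξ(η) + F(η))`, subject to the single-site constraint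
`η_x ∈ K` for all `x ∈ Λ` (floor/ceiling constraints); `F` is an extra external field
(`F = 0` for the plain SOS model). -/
def gWeight (β : ℝ) (Λ : Finset Site) (ξ : Config) (K : Set ℤ) (F : Config → ℝ)
    (η : Config) : ℝ :=
  if ∀ x ∈ Λ, η x ∈ K then Real.exp (-β * sosH Λ ξ η + F η) else 0

/-- The Gibbs probability of a set `A` of configurations: normalized sum of Gibbs
weights over all configurations agreeing with `ξ` off `Λ`. -/
def gProb (β : ℝ) (Λ : Finset Site) (ξ : Config) (K : Set ℤ) (F : Config → ℝ)
    (A : Set Config) : ℝ :=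
  (∑' g : {x // x ∈ Λ} → ℤ, Set.indicator A (gWeight β Λ ξ K F) (extendC Λ ξ g))
    / ∑' g : {x // x ∈ Λ} → ℤ, gWeight β Λ ξ K F (extendC Λ ξ g)

/-- The box `Λ_L = {1,…,L}²`. -/
def box (L : ℕ) : Finset Site := Finset.Icc ((1 : ℤ), (1 : ℤ)) ((L : ℤ), (L : ℤ))

/-- The equilibrium height `H(L) = ⌊log L / (4β)⌋`. -/
def eqHt (β : ℝ) (L : ℕ) : ℤ := ⌊Real.log L / (4 * β)⌋

/-- A dual vertex `d` represents the point `(d₁ + 1/2, d₂ + 1/2)` of the dual lattice `(ℤ²)*`. -/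
abbrev DualV : Type := ℤ × ℤ

/-- The `i`-th dual vertex of the closed circuit described by the list `l`
(indices taken cyclically). -/
def cVert (l : List DualV) (i : ℕ) : DualV := l.getD (i % l.length) (0, 0)

/-- The `i`-th bond of the circuit: the pair of consecutive dual vertices. -/
def cEdge (l : List DualV) (i : ℕ) : DualV × DualV := (cVert l i, cVert l (i + 1))

/-- The length `|γ|` of the contour (number of its bonds). -/
def cLen (l : List DualV) : ℕ := l.length

/-- The pair of bonds of the circuit meeting at the `i`-th vertex is a *linked pair*:
both bonds lie on the same side of the forty-five degrees line through that vertex. -/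
def linkedAt (l : List DualV) (i : ℕ) : Prop :=
  0 < ((cVert l (i + l.length - 1)).2 - (cVert l i).2
        - ((cVert l (i + l.length - 1)).1 - (cVert l i).1))
      * ((cVert l (i + 1)).2 - (cVert l i).2 - ((cVert l (i + 1)).1 - (cVert l i).1))

/-- `l` describes a geometric contour: a closed circuit of pairwise distinct dual bonds,
consecutive bonds sharing a vertex, obeying the splitting rule: whenever two pairs of
consecutive bonds of `γ` meet at a dual vertex, both pairs are linked. -/
def IsContour (l : List DualV) : Prop :=
  l ≠ [] ∧
  (∀ i < l.length, SiteAdj (cVert l i) (cVert l (i + 1))) ∧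
  (∀ i < l.length, ∀ j < l.length, i ≠ j →
      cEdge l i ≠ cEdge l j ∧ cEdge l i ≠ ((cEdge l j).2, (cEdge l j).1)) ∧
  (∀ i < l.length, ∀ j < l.length, i ≠ j → cVert l i = cVert l j →
      linkedAt l i ∧ linkedAt l j)

/-- The dual bond `e` crosses the horizontal ray going right from the site `x`:
`e` is a vertical dual bond at height `x₂ − 1/2 … x₂ + 1/2` to the right of `x`. -/
def crossesRay (x : Site) (e : DualV × DualV) : Prop :=
  (e.2 = (e.1.1, e.1.2 + 1) ∧ e.1.2 = x.2 - 1 ∧ x.1 ≤ e.1.1) ∨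
  (e.1 = (e.2.1, e.2.2 + 1) ∧ e.2.2 = x.2 - 1 ∧ x.1 ≤ e.2.1)

/-- The site `x` belongs to the interior `Λ_γ` of the contour: the ray from `x`
to the right crosses the contour an odd number of times. -/
def inContour (l : List DualV) (x : Site) : Prop :=
  Odd ((Finset.range l.length).filter (fun i => crossesRay x (cEdge l i))).card

/-- A bounding box containing the contour's interior. -/
def cBBox (l : List DualV) : Finset Site :=
  Finset.Icc (((l.map Prod.fst).foldr min 0) - 2, ((l.map Prod.snd).foldr min 0) - 2)
             (((l.map Prod.fst).foldr max 0) + 2, ((l.map Prod.snd).foldr max 0) + 2)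

/-- The interior area `|Λ_γ|` of the contour. -/
def cArea (l : List DualV) : ℕ := ((cBBox l).filter (fun x => inContour l x)).card

/-- The (at most two) sites of `ℤ²` at Euclidean distance `1/2` from the dual bond `e`,
i.e. the endpoints of the primal edge crossed by `e`. -/
def edgeSites (e : DualV × DualV) : Set Site :=
  {x | (e.2 = (e.1.1, e.1.2 + 1) ∧ (x = (e.1.1, e.1.2 + 1) ∨ x = (e.1.1 + 1, e.1.2 + 1))) ∨
       (e.1 = (e.2.1, e.2.2 + 1) ∧ (x = (e.2.1, e.2.2 + 1) ∨ x = (e.2.1 + 1, e.2.2 + 1))) ∨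
       (e.2 = (e.1.1 + 1, e.1.2) ∧ (x = (e.1.1 + 1, e.1.2) ∨ x = (e.1.1 + 1, e.1.2 + 1))) ∨
       (e.1 = (e.2.1 + 1, e.2.2) ∧ (x = (e.2.1 + 1, e.2.2) ∨ x = (e.2.1 + 1, e.2.2 + 1)))}

/-- The direction of the bond `e` as seen from its endpoint `d`. -/
def dirFrom (d : DualV) (e : DualV × DualV) : ℤ × ℤ := if e.1 = d then e.2 - d else e.1 - d

/-- The dual vertex `d` is a meeting point of two non-linked bonds of the contour. -/
def nonLinkedMeet (l : List DualV) (d : DualV) : Prop :=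
  ∃ i < l.length, ∃ j < l.length,
    ((cEdge l i).1 = d ∨ (cEdge l i).2 = d) ∧ ((cEdge l j).1 = d ∨ (cEdge l j).2 = d) ∧
    cEdge l i ≠ cEdge l j ∧ cEdge l i ≠ ((cEdge l j).2, (cEdge l j).1) ∧
    ((dirFrom d (cEdge l i)).2 - (dirFrom d (cEdge l i)).1) *
      ((dirFrom d (cEdge l j)).2 - (dirFrom d (cEdge l j)).1) < 0

/-- `Δ_γ`: sites at distance `1/2` from `γ`, together with sites at distance `1/√2`
from a dual vertex where two non-linked bonds of `γ` meet. -/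
def cDelta (l : List DualV) : Set Site :=
  {x | (∃ i < l.length, x ∈ edgeSites (cEdge l i)) ∨
       (∃ d : DualV, nonLinkedMeet l d ∧
          (x = d ∨ x = (d.1 + 1, d.2) ∨ x = (d.1, d.2 + 1) ∨ x = (d.1 + 1, d.2 + 1)))}

/-- `Δ_γ⁺ = Δ_γ ∩ Λ_γ`. -/
def cDeltaPlus (l : List DualV) : Set Site := {x ∈ cDelta l | inContour l x}

/-- `Δ_γ⁻ = Δ_γ \ Λ_γ`. -/
def cDeltaMinus (l : List DualV) : Set Site := {x ∈ cDelta l | ¬ inContour l x}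

/-- The event `C_{γ,h}` that `γ` is an `h`-contour for the configuration:
`η ≤ h−1` on `Δ_γ⁻` and `η ≥ h` on `Δ_γ⁺`. -/
def hContourEvent (l : List DualV) (h : ℤ) : Set Config :=
  {η | (∀ x ∈ cDeltaMinus l, η x ≤ h - 1) ∧ (∀ x ∈ cDeltaPlus l, h ≤ η x)}

/-- The bond between `a` and `b` belongs to the contour. -/
def Bd (l : List DualV) (a b : DualV) : Prop :=
  ∃ i < l.length, cEdge l i = (a, b) ∨ cEdge l i = (b, a)

/-- Indicator in `ZMod 2`. -/
def ind (P : Prop) : ZMod 2 := if P then 1 else 0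

lemma ind_true {P : Prop} (h : P) : ind P = 1 := if_pos h
lemma ind_false {P : Prop} (h : ¬ P) : ind P = 0 := if_neg h

lemma ind_inContour (l : List DualV) (x : Site) :
    ind (inContour l x) = ∑ i ∈ Finset.range l.length, ind (crossesRay x (cEdge l i)) := by
  unfold ind
  rw [Finset.sum_boole]
  unfold inContour
  split_ifs with h
  · exact ((ZMod.natCast_eq_one_iff_odd).2 h).symm
  · exact ((ZMod.natCast_eq_zero_iff_even).2 (Nat.not_odd_iff_even.1 h)).symm

lemma ind_Bd {l : List DualV} (hc : IsContour l) (a b : DualV) :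
    ind (Bd l a b) = ∑ i ∈ Finset.range l.length,
      ind (cEdge l i = (a, b) ∨ cEdge l i = (b, a)) := by
  by_cases h : Bd l a b
  · obtain ⟨i, hi, hi'⟩ := id h
    rw [ind_true h, Finset.sum_eq_single i, ind_true hi']
    · intro j hj hji
      apply ind_false
      intro hj'
      have := hc.2.2.1 j (Finset.mem_range.1 hj) i hi hji
      rcases hi' with e | e <;> rcases hj' with e' | e' <;> rw [e, e'] at this <;> simp at this
    · intro h'
      exact absurd (Finset.mem_range.2 hi) h'
  · rw [ind_false h, Finset.sum_eq_zero]
    intro i hi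
    apply ind_false
    intro h'
    exact h ⟨i, Finset.mem_range.1 hi, h'⟩

lemma xor_of_ind {P Q R : Prop} (h : ind P + ind Q = ind R) : R ↔ ¬ (P ↔ Q) := by
  unfold ind at h
  by_cases hP : P <;> by_cases hQ : Q <;> by_cases hR : R <;> simp [hP, hQ, hR] at h ⊢

lemma edge_cases {e : DualV × DualV} (h : SiteAdj e.1 e.2) :
    ∃ a b : ℤ, e = ((a, b), (a, b+1)) ∨ e = ((a, b+1), (a, b)) ∨
      e = ((a, b), (a+1, b)) ∨ e = ((a+1, b), (a, b)) := by
  obtain ⟨⟨a, b⟩, ⟨c, d⟩⟩ := e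
  unfold SiteAdj at h
  simp only at h
  have : (c = a ∧ d = b + 1) ∨ (c = a ∧ b = d + 1) ∨ (c = a + 1 ∧ d = b) ∨
    (a = c + 1 ∧ d = b) := by omega
  rcases this with ⟨rfl, rfl⟩ | ⟨rfl, rfl⟩ | ⟨rfl, rfl⟩ | ⟨rfl, rfl⟩
  · exact ⟨_, _, Or.inl rfl⟩
  · exact ⟨_, _, Or.inr (Or.inl rfl)⟩
  · exact ⟨_, _, Or.inr (Or.inr (Or.inl rfl))⟩
  · exact ⟨_, _, Or.inr (Or.inr (Or.inr rfl))⟩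

lemma cEdge_cases {l : List DualV} (hc : IsContour l) {i : ℕ} (hi : i < l.length) :
    ∃ a b : ℤ, cEdge l i = ((a, b), (a, b+1)) ∨ cEdge l i = ((a, b+1), (a, b)) ∨
      cEdge l i = ((a, b), (a+1, b)) ∨ cEdge l i = ((a+1, b), (a, b)) :=
  edge_cases (hc.2.1 i hi)

lemma two_zero (a : ZMod 2) : a + a = 0 := CharTwo.add_self_eq_zero a

lemma bd_vert {l : List DualV} (hc : IsContour l) (p q : ℤ) :
    Bd l (p, q - 1) (p, q) ↔ ¬ (inContour l (p, q) ↔ inContour l (p + 1, q)) := by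
  apply xor_of_ind
  rw [ind_inContour, ind_inContour, ind_Bd hc, ← Finset.sum_add_distrib]
  apply Finset.sum_congr rfl
  intro i hi
  obtain ⟨a, b, h | h | h | h⟩ := cEdge_cases hc (Finset.mem_range.1 hi) <;> rw [h] <;>
    unfold crossesRay ind <;> simp only [Prod.mk.injEq, true_and, and_true] <;> split_ifs <;>
    first | rfl | decide | (exfalso; omega)

lemma closed_sum {l : List DualV} (f : DualV → ZMod 2) :
    ∑ i ∈ Finset.range l.length, (f (cEdge l i).1 + f (cEdge l i).2) = 0 := by
  unfold cEdge
  rw [Finset.sum_add_distrib]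
  have h1 := Finset.sum_range_succ (fun i => f (cVert l i)) l.length
  have h2 := Finset.sum_range_succ' (fun i => f (cVert l i)) l.length
  have h3 : cVert l l.length = cVert l 0 := by simp [cVert]
  rw [h3] at h1
  rw [h1] at h2
  rw [← add_right_cancel h2]
  exact two_zero _

lemma bd_horiz {l : List DualV} (hc : IsContour l) (p q : ℤ) :
    Bd l (p - 1, q) (p, q) ↔ ¬ (inContour l (p, q) ↔ inContour l (p, q + 1)) := by
  apply xor_of_ind
  rw [ind_inContour, ind_inContour, ind_Bd hc, ← Finset.sum_add_distrib]
  have := closed_sum (l := l) (fun v => ind (v.2 = q ∧ p ≤ v.1))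
  rw [← add_zero (Finset.sum _ _), ← this, ← Finset.sum_add_distrib]
  apply Finset.sum_congr rfl
  intro i hi
  obtain ⟨a, b, h | h | h | h⟩ := cEdge_cases hc (Finset.mem_range.1 hi) <;> rw [h] <;>
    unfold crossesRay ind <;> simp only [Prod.mk.injEq, true_and, and_true] <;> split_ifs <;>
    first | rfl | decide | (exfalso; omega)

lemma mem_nbrs {x y : Site} : y ∈ nbrs x ↔
    (y.1 = x.1 + 1 ∧ y.2 = x.2) ∨ (y.1 = x.1 - 1 ∧ y.2 = x.2) ∨
    (y.1 = x.1 ∧ y.2 = x.2 + 1) ∨ (y.1 = x.1 ∧ y.2 = x.2 - 1) := by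
  simp [nbrs, Prod.ext_iff]

lemma nbrs_symm {x y : Site} : y ∈ nbrs x ↔ x ∈ nbrs y := by
  rw [mem_nbrs, mem_nbrs]; omega

/-- the two sites of a bond are separated -/
lemma edge_sites_pair {l : List DualV} (hc : IsContour l) {i : ℕ} (hi : i < l.length) :
    ∃ x y : Site, y ∈ nbrs x ∧ ¬ (inContour l x ↔ inContour l y) ∧
      edgeSites (cEdge l i) = {x, y} := by
  obtain ⟨a, b, h⟩ := cEdge_cases hc hi
  rcases or_assoc.2 h with h | h
  · refine ⟨(a, b+1), (a+1, b+1), by simp [mem_nbrs], ?_, ?_⟩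
    · rw [← bd_vert hc]
      refine ⟨i, hi, ?_⟩
      simpa using h
    · ext ⟨u, v⟩
      rcases h with h | h <;> rw [h] <;> simp [edgeSites] <;> omega
  · refine ⟨(a+1, b), (a+1, b+1), by simp [mem_nbrs], ?_, ?_⟩
    · rw [← bd_horiz hc]
      refine ⟨i, hi, ?_⟩
      simpa using h
    · ext ⟨u, v⟩
      rcases h with h | h <;> rw [h] <;> simp [edgeSites] <;> omega

lemma edge_sep {l : List DualV} (hc : IsContour l) {i : ℕ} (hi : i < l.length) :
    ∃ p : Site × Site, p.2 ∈ nbrs p.1 ∧ inContour l p.1 ∧ ¬ inContour l p.2 ∧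
      edgeSites (cEdge l i) = {p.1, p.2} := by
  obtain ⟨x, y, h1, h2, h3⟩ := edge_sites_pair hc hi
  by_cases hx : inContour l x
  · exact ⟨(x, y), h1, hx, by tauto, h3⟩
  · exact ⟨(y, x), nbrs_symm.1 h1, by tauto, hx, by rw [h3, Set.pair_comm]⟩

lemma edge_inj {e e' : DualV × DualV} (h : SiteAdj e.1 e.2) (h' : SiteAdj e'.1 e'.2)
    (hs : edgeSites e = edgeSites e') : e = e' ∨ e = (e'.2, e'.1) := by
  have key : ∀ e : DualV × DualV, SiteAdj e.1 e.2 → ∃ a b : ℤ,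
      ((e = ((a, b), (a, b+1)) ∨ e = ((a, b+1), (a, b))) ∧
        edgeSites e = {(a, b+1), (a+1, b+1)}) ∨
      ((e = ((a, b), (a+1, b)) ∨ e = ((a+1, b), (a, b))) ∧
        edgeSites e = {(a+1, b), (a+1, b+1)}) := by
    intro e h
    obtain ⟨a, b, h⟩ := edge_cases h
    refine ⟨a, b, ?_⟩
    rcases or_assoc.2 h with h | h
    · refine Or.inl ⟨h, ?_⟩
      ext ⟨u, v⟩
      rcases h with h | h <;> rw [h] <;> simp [edgeSites] <;> omega
    · refine Or.inr ⟨h, ?_⟩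
      ext ⟨u, v⟩
      rcases h with h | h <;> rw [h] <;> simp [edgeSites] <;> omega
  obtain ⟨a, b, h1⟩ := key e h
  obtain ⟨c, d, h2⟩ := key e' h'
  rcases h1 with ⟨h1, s1⟩ | ⟨h1, s1⟩ <;> rcases h2 with ⟨h2, s2⟩ | ⟨h2, s2⟩ <;>
    rw [s1, s2, Set.pair_eq_pair_iff] at hs <;> simp only [Prod.mk.injEq] at hs
  · have h3 : a = c := by omega
    have h4 : b = d := by omega
    subst h3 h4
    rcases h1 with h1 | h1 <;> rcases h2 with h2 | h2 <;> rw [h1, h2] <;> simp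
  · exfalso; omega
  · exfalso; omega
  · have h3 : a = c := by omega
    have h4 : b = d := by omega
    subst h3 h4
    rcases h1 with h1 | h1 <;> rcases h2 with h2 | h2 <;> rw [h1, h2] <;> simp

/-- A separated pair of neighbours is in `Δ`. -/
lemma sep_mem {l : List DualV} (hc : IsContour l) {x y : Site} (hy : y ∈ nbrs x)
    (h : ¬ (inContour l x ↔ inContour l y)) : x ∈ cDelta l ∧ y ∈ cDelta l := by
  have key : ∃ i < l.length, x ∈ edgeSites (cEdge l i) ∧ y ∈ edgeSites (cEdge l i) := by
    obtain ⟨x1, x2⟩ := x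
    obtain ⟨y1, y2⟩ := y
    rw [mem_nbrs] at hy
    simp only at hy
    rcases hy with ⟨rfl, rfl⟩ | ⟨rfl, rfl⟩ | ⟨rfl, rfl⟩ | ⟨rfl, rfl⟩
    · rw [← bd_vert hc] at h
      obtain ⟨i, hi, h⟩ := h
      refine ⟨i, hi, ?_⟩
      rcases h with h | h <;> rw [h] <;> simp [edgeSites]
    · have h : ¬ (inContour l (x1 - 1, y2) ↔ inContour l (x1 - 1 + 1, y2)) := by
        rw [sub_add_cancel]; tauto
      rw [← bd_vert hc] at h
      obtain ⟨i, hi, h⟩ := h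
      refine ⟨i, hi, ?_⟩
      rcases h with h | h <;> rw [h] <;> simp [edgeSites]
    · rw [← bd_horiz hc] at h
      obtain ⟨i, hi, h⟩ := h
      refine ⟨i, hi, ?_⟩
      rcases h with h | h <;> rw [h] <;> simp [edgeSites]
    · have h : ¬ (inContour l (y1, x2 - 1) ↔ inContour l (y1, x2 - 1 + 1)) := by
        rw [sub_add_cancel]; tauto
      rw [← bd_horiz hc] at h
      obtain ⟨i, hi, h⟩ := h
      refine ⟨i, hi, ?_⟩
      rcases h with h | h <;> rw [h] <;> simp [edgeSites]
  obtain ⟨i, hi, h1, h2⟩ := key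
  exact ⟨Or.inl ⟨i, hi, h1⟩, Or.inl ⟨i, hi, h2⟩⟩

lemma card_ge {l : List DualV} (hc : IsContour l) (Λ : Finset Site)
    (hΛ : ∀ x : Site, inContour l x → x ∈ Λ) :
    l.length ≤ ((Λ.sigma nbrs).filter
      (fun p => inContour l p.1 ∧ ¬ inContour l p.2)).card := by
  have : ∀ i : ℕ, ∃ p : Σ _ : Site, Site, i < l.length → (p.2 ∈ nbrs p.1 ∧ inContour l p.1 ∧
      ¬ inContour l p.2 ∧ edgeSites (cEdge l i) = {p.1, p.2}) := by
    intro i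
    by_cases hi : i < l.length
    · obtain ⟨p, hp⟩ := edge_sep hc hi
      exact ⟨⟨p.1, p.2⟩, fun _ => hp⟩
    · exact ⟨⟨0, 0⟩, fun h => absurd h hi⟩
  choose f hf using this
  calc l.length = (Finset.range l.length).card := by simp
    _ ≤ _ := by
      apply Finset.card_le_card_of_injOn f
      · intro i hi
        obtain ⟨h1, h2, h3, -⟩ := hf i (by simpa using hi)
        simp [h1, h2, h3, hΛ _ h2]
      · intro i hi j hj hij
        have hi : i < l.length := by simpa using hi
        have hj : j < l.length := by simpa using hj
        by_contra hne
        have h1 := (hf i hi).2.2.2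
        have h2 := (hf j hj).2.2.2
        rw [hij, ← h2] at h1
        have h3 := hc.2.2.1 i hi j hj hne
        rcases edge_inj (hc.2.1 i hi) (hc.2.1 j hj) h1 with h | h
        · exact h3.1 h
        · exact h3.2 h

/-- shift down the interior by one -/
def shiftC (l : List DualV) (η : Config) : Config :=
  fun x => η x - if inContour l x then 1 else 0

lemma term_diff {l : List DualV} (hc : IsContour l) {h : ℤ} {η : Config}
    (hη : η ∈ hContourEvent l h) {x y : Site} (hy : y ∈ nbrs x) :
    ((|η x - η y| : ℤ) : ℝ) = ((|shiftC l η x - shiftC l η y| : ℤ) : ℝ)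
      + (if inContour l x ∧ ¬ inContour l y then 1 else 0)
      + (if inContour l y ∧ ¬ inContour l x then 1 else 0) := by
  have key : |η x - η y| = |shiftC l η x - shiftC l η y|
      + (if inContour l x ∧ ¬ inContour l y then 1 else 0)
      + (if inContour l y ∧ ¬ inContour l x then 1 else 0) := by
    unfold shiftC
    by_cases hx : inContour l x <;> by_cases hy' : inContour l y <;> simp only [hx, hy'] <;> simp
    · obtain ⟨a, b⟩ := sep_mem hc hy (by tauto)
      have h1 := hη.2 x ⟨a, hx⟩
      have h2 := hη.1 y ⟨b, hy'⟩
      rw [abs_of_nonneg (by omega), abs_of_nonneg (by omega)]; ring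
    · obtain ⟨a, b⟩ := sep_mem hc hy (by tauto)
      have h1 := hη.1 x ⟨a, hx⟩
      have h2 := hη.2 y ⟨b, hy'⟩
      rw [abs_of_nonpos (by omega), abs_of_nonpos (by omega)]; ring
  rw [key]; push_cast; rfl

lemma energy {l : List DualV} (hc : IsContour l) (Λ : Finset Site)
    (hΛ : ∀ x : Site, inContour l x → x ∈ Λ) {h : ℤ} {η ξ : Config}
    (hη : η ∈ hContourEvent l h) (hξ : ∀ x, x ∉ Λ → η x = ξ x) :
    sosH Λ ξ (shiftC l η) + l.length ≤ sosH Λ ξ η := by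
  set a : Site → Site → ℝ := fun x y => if inContour l x ∧ ¬ inContour l y then 1 else 0 with ha
  have e1 : ∑ x ∈ Λ, ∑ y ∈ (nbrs x).filter (fun y => y ∈ Λ), ((|η x - η y| : ℤ) : ℝ)
      = ∑ x ∈ Λ, ∑ y ∈ (nbrs x).filter (fun y => y ∈ Λ),
          ((|shiftC l η x - shiftC l η y| : ℤ) : ℝ)
        + ∑ x ∈ Λ, ∑ y ∈ (nbrs x).filter (fun y => y ∈ Λ), a x y
        + ∑ x ∈ Λ, ∑ y ∈ (nbrs x).filter (fun y => y ∈ Λ), a y x := by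
    simp only [← Finset.sum_add_distrib]
    refine Finset.sum_congr rfl fun x _ => Finset.sum_congr rfl fun y hy => ?_
    exact term_diff hc hη (Finset.mem_filter.1 hy).1
  have e2 : ∑ x ∈ Λ, ∑ y ∈ (nbrs x).filter (fun y => y ∈ Λ), a y x =
      ∑ x ∈ Λ, ∑ y ∈ (nbrs x).filter (fun y => y ∈ Λ), a x y := by
    apply Finset.sum_comm'
    intro x y
    simp only [Finset.mem_filter]
    rw [nbrs_symm]; tauto
  have e3 : ∑ x ∈ Λ, ∑ y ∈ (nbrs x).filter (fun y => y ∉ Λ), ((|η x - ξ y| : ℤ) : ℝ)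
      = ∑ x ∈ Λ, ∑ y ∈ (nbrs x).filter (fun y => y ∉ Λ),
          ((|shiftC l η x - ξ y| : ℤ) : ℝ)
        + ∑ x ∈ Λ, ∑ y ∈ (nbrs x).filter (fun y => y ∉ Λ), a x y := by
    simp only [← Finset.sum_add_distrib]
    refine Finset.sum_congr rfl fun x _ => Finset.sum_congr rfl fun y hy => ?_
    obtain ⟨hy1, hy2⟩ := Finset.mem_filter.1 hy
    have hny : ¬ inContour l y := fun h => hy2 (hΛ y h)
    have := term_diff hc hη hy1
    have hs : shiftC l η y = ξ y := by simp [shiftC, hny, hξ y hy2]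
    rw [hs, hξ y hy2] at this
    rw [this]
    simp [hny, ha]
  have e4 : (l.length : ℝ) ≤ ∑ x ∈ Λ, ∑ y ∈ nbrs x, a x y := by
    rw [Finset.sum_sigma']
    simp only [ha]
    rw [Finset.sum_boole]
    exact_mod_cast card_ge hc Λ hΛ
  have e5 : ∑ x ∈ Λ, ∑ y ∈ nbrs x, a x y =
      ∑ x ∈ Λ, ∑ y ∈ (nbrs x).filter (fun y => y ∈ Λ), a x y
      + ∑ x ∈ Λ, ∑ y ∈ (nbrs x).filter (fun y => y ∉ Λ), a x y := by
    rw [← Finset.sum_add_distrib]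
    refine Finset.sum_congr rfl fun x _ => ?_
    rw [Finset.sum_filter_add_sum_filter_not]
  unfold sosH
  rw [e1, e2, e3]
  linarith

/-- The shift as an equivalence. -/
def shiftE (l : List DualV) (Λ : Finset Site) : ({x // x ∈ Λ} → ℤ) ≃ ({x // x ∈ Λ} → ℤ) :=
  Equiv.subRight (fun x => if inContour l x.1 then 1 else 0)

lemma extend_shift {l : List DualV} {Λ : Finset Site}
    (hΛ : ∀ x : Site, inContour l x → x ∈ Λ) (ξ : Config) (g : {x // x ∈ Λ} → ℤ) :
    extendC Λ ξ (shiftE l Λ g) = shiftC l (extendC Λ ξ g) := by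
  funext x
  unfold extendC shiftC shiftE
  by_cases hx : x ∈ Λ
  · simp [hx]
  · have : ¬ inContour l x := fun h => hx (hΛ x h)
    simp [hx, this]

lemma main_bound {β : ℝ} (hβ : 0 < β) {l : List DualV} (hc : IsContour l) {Λ : Finset Site}
    (hΛ : ∀ x : Site, inContour l x → x ∈ Λ) (ξ : Config) (h : ℤ) (A B : Set Config)
    (hA : A ⊆ hContourEvent l h) (hB : ∀ η ∈ A, shiftC l η ∈ B)
    (hs : Summable fun g : {x // x ∈ Λ} → ℤ =>
      gWeight β Λ ξ Set.univ (fun _ => 0) (extendC Λ ξ g)) :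
    ∑' g : {x // x ∈ Λ} → ℤ, A.indicator (gWeight β Λ ξ Set.univ (fun _ => 0)) (extendC Λ ξ g)
    ≤ Real.exp (-β * (cLen l : ℝ)) *
      ∑' g : {x // x ∈ Λ} → ℤ,
        B.indicator (gWeight β Λ ξ Set.univ (fun _ => 0)) (extendC Λ ξ g) := by
  have hw : ∀ η, gWeight β Λ ξ Set.univ (fun _ => 0) η = Real.exp (-β * sosH Λ ξ η) := by
    intro η; simp [gWeight]
  have hsum : ∀ C : Set Config, Summable fun g : {x // x ∈ Λ} → ℤ =>
      C.indicator (gWeight β Λ ξ Set.univ (fun _ => 0)) (extendC Λ ξ g) := by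
    intro C
    refine Summable.of_nonneg_of_le (fun g => ?_) (fun g => ?_) hs
    · exact Set.indicator_nonneg (fun η _ => by rw [hw]; positivity) _
    · exact Set.indicator_le_self' (fun η _ => by rw [hw]; positivity) _
  rw [← (shiftE l Λ).tsum_eq (fun g : {x // x ∈ Λ} → ℤ =>
    B.indicator (gWeight β Λ ξ Set.univ (fun _ => 0)) (extendC Λ ξ g)), ← tsum_mul_left]
  refine Summable.tsum_le_tsum (fun g => ?_) (hsum A) ?_
  · rw [extend_shift hΛ]
    by_cases hg : extendC Λ ξ g ∈ A
    · rw [Set.indicator_of_mem hg, Set.indicator_of_mem (hB _ hg), hw, hw, ← Real.exp_add]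
      apply Real.exp_le_exp.2
      have := energy hc Λ hΛ (hA hg) (ξ := ξ) (fun x hx => by simp [extendC, hx])
      unfold cLen
      nlinarith
    · rw [Set.indicator_of_notMem hg]
      exact mul_nonneg (Real.exp_pos _).le
        (Set.indicator_nonneg (fun η _ => by rw [hw]; positivity) _)
  · exact ((shiftE l Λ).summable_iff.2 (hsum B)).mul_left _

set_option maxHeartbeats 1000000 in
lemma delta_sub {l l' : List DualV} (hc : IsContour l) (hc' : IsContour l')
    (hsub : ∀ x : Site, inContour l x → inContour l' x) {x : Site}
    (hx : inContour l x) (hx' : x ∈ cDelta l') : x ∈ cDelta l := by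
  by_contra hn
  have hin : ∀ y ∈ nbrs x, inContour l y := by
    intro y hy
    by_contra hny
    exact hn (sep_mem hc hy (by tauto)).1
  rcases hx' with ⟨i, hi, hi'⟩ | ⟨d, ⟨i, hi, j, hj, di, dj, -, -, hprod⟩, hxd⟩
  · obtain ⟨u, v, h1, h2, h3⟩ := edge_sites_pair hc' hi
    rw [h3] at hi'
    rcases hi' with rfl | rfl
    · have := hsub _ (hin _ h1)
      have := hsub _ hx
      tauto
    · have := hsub _ (hin _ (nbrs_symm.1 h1))
      have := hsub _ hx
      tauto
  · obtain ⟨p, q⟩ := d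
    -- classification of bonds at the vertex
    have cls : ∀ i < l'.length, ((cEdge l' i).1 = (p, q) ∨ (cEdge l' i).2 = (p, q)) →
        (Bd l' (p, q) (p, q + 1) ∧ (dirFrom (p, q) (cEdge l' i)).2
          - (dirFrom (p, q) (cEdge l' i)).1 = 1) ∨
        (Bd l' (p, q - 1) (p, q) ∧ (dirFrom (p, q) (cEdge l' i)).2
          - (dirFrom (p, q) (cEdge l' i)).1 = -1) ∨
        (Bd l' (p, q) (p + 1, q) ∧ (dirFrom (p, q) (cEdge l' i)).2
          - (dirFrom (p, q) (cEdge l' i)).1 = -1) ∨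
        (Bd l' (p - 1, q) (p, q) ∧ (dirFrom (p, q) (cEdge l' i)).2
          - (dirFrom (p, q) (cEdge l' i)).1 = 1) := by
      intro i hi hd
      obtain ⟨a, b, h | h | h | h⟩ := cEdge_cases hc' hi <;> rw [h] at hd <;>
        simp only [Prod.mk.injEq] at hd <;> rcases hd with ⟨rfl, rfl⟩ | ⟨rfl, rfl⟩
      · exact Or.inl ⟨⟨i, hi, by simp [h]⟩, by simp [h, dirFrom]⟩
      · exact Or.inr (Or.inl ⟨⟨i, hi, by simp [h]⟩, by simp [h, dirFrom]⟩)
      · exact Or.inr (Or.inl ⟨⟨i, hi, by simp [h]⟩, by simp [h, dirFrom]⟩)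
      · exact Or.inl ⟨⟨i, hi, by simp [h]⟩, by simp [h, dirFrom]⟩
      · exact Or.inr (Or.inr (Or.inl ⟨⟨i, hi, by simp [h]⟩, by simp [h, dirFrom]⟩))
      · exact Or.inr (Or.inr (Or.inr ⟨⟨i, hi, by simp [h]⟩, by simp [h, dirFrom]⟩))
      · exact Or.inr (Or.inr (Or.inr ⟨⟨i, hi, by simp [h]⟩, by simp [h, dirFrom]⟩))
      · exact Or.inr (Or.inr (Or.inl ⟨⟨i, hi, by simp [h]⟩, by simp [h, dirFrom]⟩))
    have bn : ∀ l : List DualV, IsContour l → (Bd l (p, q) (p, q + 1) ↔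
        ¬ (inContour l (p, q + 1) ↔ inContour l (p + 1, q + 1))) := by
      intro l hc; simpa using bd_vert hc p (q + 1)
    have bs := fun (l : List DualV) (hc : IsContour l) => bd_vert hc p q
    have be : ∀ l : List DualV, IsContour l → (Bd l (p, q) (p + 1, q) ↔
        ¬ (inContour l (p + 1, q) ↔ inContour l (p + 1, q + 1))) := by
      intro l hc; simpa using bd_horiz hc (p + 1) q
    have bw := fun (l : List DualV) (hc : IsContour l) => bd_horiz hc p q
    have ci := cls i hi di
    have cj := cls j hj dj
    rw [bn l' hc', bs l' hc', be l' hc', bw l' hc'] at ci cj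
    generalize (dirFrom (p, q) (cEdge l' i)).2 - (dirFrom (p, q) (cEdge l' i)).1 = s at *
    generalize (dirFrom (p, q) (cEdge l' j)).2 - (dirFrom (p, q) (cEdge l' j)).1 = t at *
    have hst : (s = 1 ∧ t ≠ 1) ∨ (s = -1 ∧ t ≠ -1) := by
      have hs : s = 1 ∨ s = -1 := by
        rcases ci with h | h | h | h
        · exact Or.inl h.2
        · exact Or.inr h.2
        · exact Or.inr h.2
        · exact Or.inl h.2
      rcases hs with rfl | rfl
      · left; refine ⟨rfl, ?_⟩; rintro rfl; norm_num at hprod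
      · right; refine ⟨rfl, ?_⟩; rintro rfl; norm_num at hprod
    have s1 := hsub (p, q)
    have s2 := hsub (p + 1, q)
    have s3 := hsub (p, q + 1)
    have s4 := hsub (p + 1, q + 1)
    have ne1 : (1 : ℤ) ≠ -1 := by norm_num
    rcases hxd with rfl | rfl | rfl | rfl
    · have n1 := hin (p + 1, q) (by simp [mem_nbrs])
      have n2 := hin (p, q + 1) (by simp [mem_nbrs])
      have hout : ¬ inContour l' (p + 1, q + 1) := by
        intro hz
        simp [s1 hx, s2 n1, s3 n2, hz] at ci
      have hz : ¬ inContour l (p + 1, q + 1) := fun h => hout (s4 h)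
      obtain ⟨i', hi', h1⟩ := (bn l hc).2 (fun h => hz (h.1 n2))
      obtain ⟨j', hj', h2⟩ := (be l hc).2 (fun h => hz (h.1 n1))
      refine hn (Or.inr ⟨(p, q), ⟨i', hi', j', hj', ?_⟩, by simp⟩)
      rcases h1 with h1 | h1 <;> rcases h2 with h2 | h2 <;> simp [h1, h2, dirFrom]
    · have n1 := hin (p, q) (by simp [mem_nbrs])
      have n2 := hin (p + 1, q + 1) (by simp [mem_nbrs])
      simp only at hx
      simp only [s1 n1, s2 hx, s4 n2] at ci cj
      simp at ci cj
      omega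
    · have n1 := hin (p, q) (by simp [mem_nbrs])
      have n2 := hin (p + 1, q + 1) (by simp [mem_nbrs])
      simp only at hx
      simp only [s1 n1, s3 hx, s4 n2] at ci cj
      simp at ci cj
      omega
    · have n1 := hin (p + 1, q) (by simp [mem_nbrs])
      have n2 := hin (p, q + 1) (by simp [mem_nbrs])
      simp only at hx
      have hout : ¬ inContour l' (p, q) := by
        intro hz
        simp [s4 hx, s2 n1, s3 n2, hz] at ci
      have hz : ¬ inContour l (p, q) := fun h => hout (s1 h)
      obtain ⟨i', hi', h1⟩ := (bs l hc).2 (fun h => hz (h.2 n1))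
      obtain ⟨j', hj', h2⟩ := (bw l hc).2 (fun h => hz (h.2 n2))
      refine hn (Or.inr ⟨(p, q), ⟨i', hi', j', hj', ?_⟩, by simp⟩)
      rcases h1 with h1 | h1 <;> rcases h2 with h2 | h2 <;> simp [h1, h2, dirFrom]

/-- Lemma 3.7 of the paper. For any `β > 0`, any finite `Λ ⊂ ℤ²`,
any boundary condition `ξ`, any `h ∈ ℤ` and any contour `γ` in `Λ`, the SOS measure
without floor and without ceiling satisfies `π̂_Λ^ξ(C_{γ,h}) ≤ exp(−β|γ|)`; moreover
if `h' < h` and `γ, γ'` are contours with `Λ_γ ⊆ Λ_{γ'}` then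
`π̂_Λ^ξ(C_{γ,h} | C_{γ',h'}) ≤ exp(−β|γ|)`. -/
theorem sos_nofloor_contour_bound :
    ∀ β : ℝ, 0 < β → ∀ Λ : Finset Site, ∀ ξ : Config, ∀ h : ℤ, ∀ l : List DualV,
      IsContour l → (∀ x : Site, inContour l x → x ∈ Λ) →
      gProb β Λ ξ Set.univ (fun _ => 0) (hContourEvent l h) ≤
          Real.exp (-β * (cLen l : ℝ)) ∧
        ∀ h' : ℤ, h' < h → ∀ l' : List DualV, IsContour l' →
          (∀ x : Site, inContour l' x → x ∈ Λ) →
          (∀ x : Site, inContour l x → inContour l' x) →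
          gProb β Λ ξ Set.univ (fun _ => 0) (hContourEvent l h ∩ hContourEvent l' h') /
              gProb β Λ ξ Set.univ (fun _ => 0) (hContourEvent l' h') ≤
            Real.exp (-β * (cLen l : ℝ)) := by
  intro β hβ Λ ξ h l hc hΛ
  by_cases hs : Summable fun g : {x // x ∈ Λ} → ℤ =>
      gWeight β Λ ξ Set.univ (fun _ => 0) (extendC Λ ξ g)
  swap
  · have hz : ∀ A, gProb β Λ ξ Set.univ (fun _ => 0) A = 0 := by
      intro A
      unfold gProb
      rw [tsum_eq_zero_of_not_summable hs, div_zero]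
    refine ⟨by rw [hz]; positivity, ?_⟩
    intros
    rw [hz, zero_div]; positivity
  have hw : ∀ η, 0 < gWeight β Λ ξ Set.univ (fun _ => 0) η := by
    intro η; simp [gWeight, Real.exp_pos]
  have hZ : 0 < ∑' g : {x // x ∈ Λ} → ℤ,
      gWeight β Λ ξ Set.univ (fun _ => 0) (extendC Λ ξ g) :=
    hs.tsum_pos (fun g => (hw _).le) 0 (hw _)
  constructor
  · have := main_bound hβ hc hΛ ξ h (hContourEvent l h) Set.univ subset_rfl
      (fun _ _ => trivial) hs
    unfold gProb
    rw [div_le_iff₀ hZ]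
    simpa using this
  · intro h' hh l' hc' _ hsub
    unfold gProb
    rw [div_div_div_cancel_right₀ hZ.ne']
    refine div_le_of_le_mul₀ ?_ (Real.exp_pos _).le ?_
    · exact tsum_nonneg fun g => Set.indicator_nonneg (fun η _ => (hw η).le) _
    refine main_bound hβ hc hΛ ξ h _ _ Set.inter_subset_left ?_ hs
    rintro η ⟨h1, h2⟩
    refine ⟨fun x hx => ?_, fun x hx => ?_⟩
    · have := h2.1 x hx
      unfold shiftC
      split_ifs <;> omega
    · have h3 := h2.2 x hx
      unfold shiftC
      split_ifs with hin
      · have := h1.2 x ⟨delta_sub hc hc' hsub hin hx.1, hin⟩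
        omega
      · omega

end SOSPaper
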